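/- Let Ω ⊂ ℝ^N, N > 2, be a bounded domain with smooth boundary, and let λ* be the supremum of all λ ∈ ℝ such that ∫_Ω |∇u|² dx − (1/4)∫_Ω |u|²/dist(x,∂Ω)² dx − λ∫_Ω |u|² dx ≥ 0 for all u ∈ C_0^∞(Ω) (λ* > −∞ and is attained). Then for every λ < λ* there exists a constant C_λ > 0 such that ∫_Ω |∇u|² dx − (1/4)∫_Ω |u|²/dist(x,∂Ω)² dx − λ∫_Ω |u|² dx ≥ C_λ (∫_Ω |u|^{2*} dx)^{2/2*} for all u ∈ C_0^∞(Ω). -/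

import Mathlib

open MeasureTheory Filter Topology

noncomputable section

abbrev Euc (N : ℕ) := EuclideanSpace ℝ (Fin N)

/-- `u` is a test function on `Ω`, i.e. `u ∈ C_0^∞(Ω)`. -/
def TestFun {N : ℕ} (Ω : Set (Euc N)) (u : Euc N → ℝ) : Prop :=
  ContDiff ℝ (⊤ : ℕ∞) u ∧ HasCompactSupport u ∧ tsupport u ⊆ Ω

/-- `V ∈ L^∞_loc(Ω)`: `V` is bounded on every compact subset of `Ω`. -/
def LocBdd {N : ℕ} (Ω : Set (Euc N)) (V : Euc N → ℝ) : Prop :=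
  ∀ K : Set (Euc N), IsCompact K → K ⊆ Ω → ∃ C : ℝ, ∀ x ∈ K, |V x| ≤ C

/-- The functional `Q(u) = ∫_Ω (|∇u|^p + V|u|^p) dx`. -/
def Qfun {N : ℕ} (Ω : Set (Euc N)) (V : Euc N → ℝ) (p : ℝ) (u : Euc N → ℝ) : ℝ :=
  ∫ x in Ω, (‖gradient u x‖ ^ p + V x * |u x| ^ p)

/-- The critical Sobolev exponent `p* = pN/(N-p)`. -/
def pStar (p : ℝ) (N : ℕ) : ℝ := p * N / (N - p)

/-- `φ ∈ C¹(Ω)` is a ground state of the functional `Q`: it is an `L^p_loc(Ω)`-limit of a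
null sequence, i.e. a sequence of nonnegative test functions `φk` with `Q(φk) → 0` and
`∫_B |φk|^p dx = 1` for some fixed open set `B` compactly contained in `Ω`. -/
def IsGroundState {N : ℕ} (Ω : Set (Euc N)) (V : Euc N → ℝ) (p : ℝ) (φ : Euc N → ℝ) : Prop :=
  ContDiffOn ℝ 1 φ Ω ∧
  ∃ (φk : ℕ → Euc N → ℝ) (B : Set (Euc N)),
    IsOpen B ∧ B.Nonempty ∧ IsCompact (closure B) ∧ closure B ⊆ Ω ∧
    (∀ k, TestFun Ω (φk k) ∧ ∀ x, 0 ≤ φk k x) ∧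
    Tendsto (fun k => Qfun Ω V p (φk k)) atTop (𝓝 0) ∧
    (∀ k, ∫ x in B, |φk k x| ^ p = 1) ∧
    (∀ K : Set (Euc N), IsCompact K → K ⊆ Ω →
      Tendsto (fun k => ∫ x in K, |φk k x - φ x| ^ p) atTop (𝓝 0))

/-- `Ω` has smooth (`C^∞`) boundary: near every boundary point, `Ω` is the sublevel set of a
smooth function with nonvanishing differential. -/
def HasSmoothBoundary {N : ℕ} (Ω : Set (Euc N)) : Prop :=
  ∀ x ∈ frontier Ω, ∃ (U : Set (Euc N)) (f : Euc N → ℝ),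
    IsOpen U ∧ x ∈ U ∧ ContDiff ℝ (⊤ : ℕ∞) f ∧ (∀ y ∈ U, fderiv ℝ f y ≠ 0) ∧
    Ω ∩ U = {y ∈ U | f y < 0}

namespace HSM

/-- Divergence of a vector field. -/
def dv {N : ℕ} (F : Euc N → Euc N) (x : Euc N) : ℝ :=
  ∑ j, (fderiv ℝ F x (EuclideanSpace.single j 1)) j

/-- The inverse distance to the boundary. -/
def dinv {N : ℕ} (Ω : Set (Euc N)) (x : Euc N) : ℝ := (Metric.infDist x (frontier Ω))⁻¹

lemma dinv_nonneg {N : ℕ} (Ω : Set (Euc N)) (x : Euc N) : 0 ≤ dinv Ω x :=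
  inv_nonneg.2 Metric.infDist_nonneg

lemma dinv_cont {N : ℕ} {Ω : Set (Euc N)} (hΩ : IsOpen Ω) : ContinuousOn (dinv Ω) Ω := by
  rcases (frontier Ω).eq_empty_or_nonempty with h | h
  · have : dinv Ω = fun _ => 0 := by
      funext x; simp [dinv, h]
    rw [this]; exact continuousOn_const
  · intro x hx
    refine ContinuousAt.continuousWithinAt ?_
    refine ContinuousAt.inv₀ (Metric.continuous_infDist_pt _).continuousAt ?_
    intro h0
    have := (isClosed_frontier.mem_iff_infDist_zero h).2 h0
    rw [hΩ.frontier_eq] at this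
    exact this.2 hx

lemma sum_coord {N : ℕ} (L : Euc N →L[ℝ] ℝ) (v : Euc N) :
    ∑ j, L (EuclideanSpace.single j 1) * v j = L v := by
  conv_rhs => rw [← (EuclideanSpace.basisFun (Fin N) ℝ).sum_repr v]
  simp [map_sum, mul_comm]

lemma dv_smul {N : ℕ} {w : Euc N → ℝ} {V : Euc N → Euc N} {x : Euc N}
    (hw : DifferentiableAt ℝ w x) (hV : DifferentiableAt ℝ V x) :
    dv (fun y => w y • V y) x = w x * dv V x + fderiv ℝ w x (V x) := by
  unfold dv
  rw [fderiv_fun_smul hw hV, ← sum_coord (fderiv ℝ w x) (V x), Finset.mul_sum,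
    ← Finset.sum_add_distrib]
  simp

lemma dv_congr {N : ℕ} {V W : Euc N → Euc N} {x : Euc N} (h : V =ᶠ[𝓝 x] W) :
    dv V x = dv W x := by
  unfold dv; rw [h.fderiv_eq]

lemma intg {N : ℕ} {Ω K : Set (Euc N)} (hK : IsCompact K) {g : Euc N → ℝ}
    (hg : ContinuousOn g K) (h0 : ∀ x, x ∉ K → g x = 0) : IntegrableOn g Ω := by
  have h1 : IntegrableOn g K := hg.integrableOn_compact hK
  rw [integrableOn_iff_integrable_of_support_subset] at h1
  · exact h1.integrableOn
  · intro x hx; by_contra h; exact hx (h0 x h)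

lemma setInt {N : ℕ} {Ω : Set (Euc N)} {g : Euc N → ℝ} (h0 : ∀ x, x ∉ Ω → g x = 0) :
    ∫ x in Ω, g x = ∫ x, g x := by
  apply setIntegral_eq_integral_of_forall_compl_eq_zero h0

lemma div_zero_int {N : ℕ} {H : Euc N → Euc N} (hH : ContDiff ℝ 1 H) (hc : HasCompactSupport H) :
    ∫ x, dv H x = 0 := by
  unfold dv
  have hd : ∀ x, DifferentiableAt ℝ H x := fun x => (hH.differentiable one_ne_zero) x
  have hcf : Continuous (fderiv ℝ H) := hH.continuous_fderiv one_ne_zero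
  have hI : ∀ j : Fin N, Integrable
      (fun x => (fderiv ℝ H x (EuclideanSpace.single j 1)) j) := by
    intro j
    apply Continuous.integrable_of_hasCompactSupport
    · fun_prop
    · have := hc.fderiv (𝕜 := ℝ)
      exact this.comp_left (g := fun L : Euc N →L[ℝ] Euc N => (L (EuclideanSpace.single j 1)) j)
        (by simp)
  rw [integral_finsetSum _ (fun j _ => hI j)]
  apply Finset.sum_eq_zero
  intro j _
  have hj : ∀ x, fderiv ℝ (fun y => H y j) x (EuclideanSpace.single j 1)
      = (fderiv ℝ H x (EuclideanSpace.single j 1)) j := by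
    intro x
    have := ((EuclideanSpace.proj (𝕜 := ℝ) j).hasFDerivAt.comp x (hd x).hasFDerivAt).fderiv
    have h2 : (⇑(EuclideanSpace.proj (𝕜 := ℝ) j) ∘ H) = fun y => H y j := by
      funext y; simp
    rw [h2] at this
    rw [this]; simp
  have hcj : HasCompactSupport (fun y => H y j) :=
    hc.comp_left (g := fun v : Euc N => v j) (by simp)
  have hcont : Continuous (fun y => H y j) := by
    have := hH.continuous
    fun_prop
  have key := integral_mul_fderiv_eq_neg_fderiv_mul_of_integrable (μ := (volume : Measure (Euc N)))
    (f := fun _ : Euc N => (1 : ℝ)) (g := fun y => H y j) (v := EuclideanSpace.single j 1)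
    (by simp) (by simpa [hj] using hI j)
    (by simpa using hcont.integrable_of_hasCompactSupport hcj)
    (fun x _ => by fun_prop) (fun x _ => by
      have := hd x
      fun_prop)
  simpa [hj] using key

/-- Integration by parts. -/
lemma ibp {N : ℕ} {Ω : Set (Euc N)} (hΩ : IsOpen Ω) {w : Euc N → ℝ} {V : Euc N → Euc N}
    (hw : ContDiff ℝ 1 w) (hc : HasCompactSupport w) (hs : tsupport w ⊆ Ω)
    (hV : ContDiffOn ℝ 1 V Ω) :
    ∫ x in Ω, (w x * dv V x + fderiv ℝ w x (V x)) = 0 := by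
  have hVat : ∀ x ∈ Ω, ContDiffAt ℝ 1 V x := fun x hx => hV.contDiffAt (hΩ.mem_nhds hx)
  have hsm : ContDiff ℝ 1 (fun y => w y • V y) := by
    rw [contDiff_iff_contDiffAt]
    intro x
    by_cases hx : x ∈ tsupport w
    · exact hw.contDiffAt.smul (hVat x (hs hx))
    · have : (fun y => w y • V y) =ᶠ[𝓝 x] fun _ => 0 := by
        have := notMem_tsupport_iff_eventuallyEq.1 hx
        filter_upwards [this] with y hy
        simp [hy]
      exact contDiffAt_const.congr_of_eventuallyEq this
  have h0 := div_zero_int hsm (hc.smul_right (f' := V))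
  rw [← h0, ← setInt (Ω := Ω)]
  · apply setIntegral_congr_fun hΩ.measurableSet
    intro x hx
    exact (dv_smul ((hw.differentiable one_ne_zero) x)
      ((hVat x hx).differentiableAt one_ne_zero)).symm
  · intro x hx
    have hx' : x ∉ tsupport w := fun h => hx (hs h)
    have : (fun y => w y • V y) =ᶠ[𝓝 x] fun _ => 0 := by
      have := notMem_tsupport_iff_eventuallyEq.1 hx'
      filter_upwards [this] with y hy
      simp [hy]
    rw [dv_congr this]; simp [dv]

lemma dv_cont {N : ℕ} {Ω : Set (Euc N)} (hΩ : IsOpen Ω) {V : Euc N → Euc N}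
    (hV : ContDiffOn ℝ 1 V Ω) : ContinuousOn (dv V) Ω := by
  unfold dv
  have := hV.continuousOn_fderiv_of_isOpen hΩ le_rfl
  fun_prop

lemma norm_grad {N : ℕ} (f : Euc N → ℝ) (y : Euc N) : ‖gradient f y‖ = ‖fderiv ℝ f y‖ := by
  rw [← toDual_gradient, LinearIsometryEquiv.norm_map]

end HSM
namespace HSM

lemma calc1 {A K a D d p q : ℝ} (hA : 0 ≤ A) (hK : 0 ≤ K) (ha : 1 ≤ a) (hd : 0 < d)
    (hD : D = d⁻¹) (h1 : (a ^ 2)⁻¹ ≤ d * (1 + A * d)) (h2 : d ≤ A * (a ^ 2)⁻¹)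
    (hp : |p - 1| ≤ A * (a ^ 2)⁻¹) (hq : |q| ≤ A) :
    (a ^ 2 / 2 - a) ^ 2 + (-a ^ 4 / 2 + a ^ 3 / 2) * p + (a ^ 2 / 2 - a) * q + K * D + D ^ 2 / 4
      ≤ 4 * (1 + 2 * A + K + A ^ 2 / 2) ^ 3 + K * A ^ 2 + A ^ 4 / 4 := by
  have ha0 : 0 < a := by linarith
  have ha2 : 0 < a ^ 2 := by positivity
  have hD0 : 0 < D := by rw [hD]; positivity
  have hdD : d * D = 1 := by rw [hD]; field_simp
  have hai : a ^ 2 * (a ^ 2)⁻¹ = 1 := by field_simp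
  set b := (a ^ 2)⁻¹ with hb
  have hb0 : 0 < b := by positivity
  have hDle : D ≤ a ^ 2 + A ^ 2 := by
    have e1 : D * b ≤ 1 + A * d := by
      calc D * b ≤ D * (d * (1 + A * d)) := by gcongr
        _ = (d * D) * (1 + A * d) := by ring
        _ = 1 + A * d := by rw [hdD]; ring
    have e2 : D = a ^ 2 * (D * b) := by
      calc D = D * (a ^ 2 * b) := by rw [hai]; ring
        _ = _ := by ring
    calc D = a ^ 2 * (D * b) := e2
      _ ≤ a ^ 2 * (1 + A * d) := by gcongr
      _ ≤ a ^ 2 * (1 + A * (A * b)) := by gcongr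
      _ = a ^ 2 + A ^ 2 * (a ^ 2 * b) := by ring
      _ = _ := by rw [hai]; ring
  have hD2 : D ^ 2 ≤ (a ^ 2 + A ^ 2) ^ 2 := by gcongr
  have hKD : K * D ≤ K * (a ^ 2 + A ^ 2) := by gcongr
  have hψ' : |(-a ^ 4 / 2 + a ^ 3 / 2)| ≤ a ^ 4 / 2 := by
    rw [abs_le]; constructor
    · nlinarith [pow_pos ha0 3]
    · nlinarith [pow_pos ha0 3, pow_pos ha0 4]
  have hP : (-a ^ 4 / 2 + a ^ 3 / 2) * p ≤ (-a ^ 4 / 2 + a ^ 3 / 2) + A * a ^ 2 / 2 := by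
    have : (-a ^ 4 / 2 + a ^ 3 / 2) * (p - 1) ≤ a ^ 4 / 2 * (A * b) := by
      calc _ ≤ |(-a ^ 4 / 2 + a ^ 3 / 2) * (p - 1)| := le_abs_self _
        _ = |(-a ^ 4 / 2 + a ^ 3 / 2)| * |(p - 1)| := abs_mul _ _
        _ ≤ _ := by gcongr
    have e : a ^ 4 / 2 * (A * b) = A * a ^ 2 / 2 := by
      calc _ = A * a ^ 2 / 2 * (a ^ 2 * b) := by ring
        _ = _ := by rw [hai]; ring
    linarith
  have hQ : (a ^ 2 / 2 - a) * q ≤ (a ^ 2 / 2 + a) * A := by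
    calc _ ≤ |(a ^ 2 / 2 - a) * q| := le_abs_self _
      _ = |(a ^ 2 / 2 - a)| * |q| := abs_mul _ _
      _ ≤ _ := by
        gcongr
        rw [abs_le]; constructor <;> nlinarith
  set B := 1 + 2 * A + K + A ^ 2 / 2 with hB
  have hB0 : 0 < B := by positivity
  have hfin : B * a ^ 2 - a ^ 3 / 2 ≤ 4 * B ^ 3 := by
    by_cases hc : a ≤ 2 * B
    · have : a ^ 2 ≤ (2 * B) ^ 2 := by gcongr
      nlinarith [pow_pos ha0 3]
    · push Not at hc
      have : B * a ^ 2 - a ^ 3 / 2 = a ^ 2 * (B - a / 2) := by ring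
      rw [this]
      have : a ^ 2 * (B - a / 2) ≤ 0 := by
        apply mul_nonpos_of_nonneg_of_nonpos ha2.le; linarith
      have : 0 < B ^ 3 := by positivity
      linarith
  have hA2 : a * A ≤ a ^ 2 * A := by
    have : a ≤ a ^ 2 := by nlinarith
    gcongr
  have hfin' : (1 + 2 * A + K + A ^ 2 / 2) * a ^ 2 - a ^ 3 / 2 ≤ 4 * B ^ 3 := by
    rw [← hB]; exact hfin
  clear_value B
  ring_nf at *
  linarith

end HSM
namespace HSM

open scoped RealInnerProductSpace

lemma infDist_le_of_notMem {N : ℕ} {Ω : Set (Euc N)} {y w : Euc N}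
    (hy : y ∈ Ω) (hw : w ∉ Ω) : Metric.infDist y (frontier Ω) ≤ dist y w := by
  have hne : Ω ≠ Set.univ := fun h => hw (h ▸ Set.mem_univ w)
  obtain ⟨z, hz, hzd⟩ := exists_mem_frontier_infDist_compl_eq_dist hy hne
  calc Metric.infDist y (frontier Ω) ≤ dist y z := Metric.infDist_le_dist_of_mem hz
    _ = Metric.infDist y Ωᶜ := hzd.symm
    _ ≤ dist y w := Metric.infDist_le_dist_of_mem hw

lemma geo {N : ℕ} {Ω : Set (Euc N)} (hΩ : IsOpen Ω) (hsm : HasSmoothBoundary Ω) {x : Euc N}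
    (hx : x ∈ frontier Ω) :
    ∃ (r : ℝ) (ρ : Euc N → ℝ) (ν : Euc N → Euc N) (n : Euc N) (A : ℝ), 0 < r ∧ 0 ≤ A ∧
      ContDiffOn ℝ 1 ρ (Metric.ball x r) ∧ ContDiffOn ℝ 1 ν (Metric.ball x r) ∧
      ∀ y ∈ Metric.ball x r, y ∈ Ω →
        0 < ρ y ∧ ρ y ≤ 1 / 16 ∧ ‖ν y‖ = 1 ∧ 1 / 2 ≤ ⟪n, ν y⟫ ∧
        |fderiv ℝ ρ y (ν y) - 1| ≤ A * ρ y ∧ |dv ν y| ≤ A ∧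
        0 < Metric.infDist y (frontier Ω) ∧
        ρ y ≤ Metric.infDist y (frontier Ω) * (1 + A * Metric.infDist y (frontier Ω)) ∧
        Metric.infDist y (frontier Ω) ≤ A * ρ y := by
  obtain ⟨U, f, hU, hxU, hf, hf', hUf⟩ := hsm x hx
  have hfront : ∀ z ∈ frontier Ω, z ∈ U → f z = 0 := by
    intro z hz hzU
    rw [hΩ.frontier_eq] at hz
    apply le_antisymm
    · by_contra hpos
      push Not at hpos
      have hO : IsOpen (U ∩ f ⁻¹' Set.Ioi 0) := hU.inter (isOpen_Ioi.preimage hf.continuous)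
      obtain ⟨p, hp1, hp2⟩ := mem_closure_iff.1 hz.1 _ hO ⟨hzU, hpos⟩
      have : p ∈ {y ∈ U | f y < 0} := hUf ▸ ⟨hp2, hp1.1⟩
      have h1 := this.2
      have h2 : 0 < f p := hp1.2
      linarith
    · by_contra hneg
      push Not at hneg
      have : z ∈ Ω ∩ U := by rw [hUf]; exact ⟨hzU, hneg⟩
      exact hz.2 this.1
  have hneg : ∀ y ∈ Ω, y ∈ U → f y < 0 := by
    intro y hy hyU
    have : y ∈ {y ∈ U | f y < 0} := hUf ▸ ⟨hy, hyU⟩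
    exact this.2
  set g : Euc N → Euc N := gradient f with hgdef
  have hgsm : ContDiff ℝ 2 g := by
    have h1 : ContDiff ℝ 2 (fderiv ℝ f) := by
      have h3 : ContDiff ℝ 3 f := by exact_mod_cast contDiff_infty.1 hf 3
      exact h3.fderiv_right (by norm_num)
    exact (InnerProductSpace.toDual ℝ (Euc N)).symm.contDiff.comp h1
  have hg0 : ∀ y ∈ U, g y ≠ 0 := by
    intro y hy h0
    apply hf' y hy
    rw [← norm_eq_zero, ← norm_grad, ← hgdef, h0, norm_zero]
  have hf2 : ContDiff ℝ 2 f := by exact_mod_cast contDiff_infty.1 hf 2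
  have hgi : ∀ y v, fderiv ℝ f y v = ⟪g y, v⟫ := fun y v => inner_gradient_left.symm
  set h : Euc N → ℝ := fun y => ‖g y‖⁻¹ with hhdef
  have hhs : ContDiffOn ℝ 2 h U := by
    intro y hy
    exact ((hgsm.contDiffAt.norm ℝ (hg0 y hy)).inv
      (norm_ne_zero_iff.2 (hg0 y hy))).contDiffWithinAt
  set ρ : Euc N → ℝ := fun y => -(f y * h y) with hρdef
  set ν : Euc N → Euc N := fun y => -(h y • g y) with hνdef
  have hρs : ContDiffOn ℝ 2 ρ U := (hf2.contDiffOn.mul hhs).neg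
  have hνs : ContDiffOn ℝ 2 ν U := (hhs.smul hgsm.contDiffOn).neg
  have hm : 0 < ‖g x‖ := norm_pos_iff.2 (hg0 x hxU)
  set m := ‖g x‖ with hmdef
  have hhm : ∀ y ∈ U, h y * ‖g y‖ = 1 := fun y hy =>
    inv_mul_cancel₀ (norm_ne_zero_iff.2 (hg0 y hy))
  have hh0 : ∀ y ∈ U, 0 < h y := fun y hy => inv_pos.2 (norm_pos_iff.2 (hg0 y hy))
  have hν1 : ∀ y ∈ U, ‖ν y‖ = 1 := by
    intro y hy
    simp only [hνdef, norm_neg, norm_smul, Real.norm_eq_abs, abs_of_pos (hh0 y hy)]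
    exact hhm y hy
  have hfx : f x = 0 := hfront x hx hxU
  -- neighbourhood
  have ev : ∀ᶠ y in 𝓝 x, y ∈ U ∧ ‖fderiv ℝ f y - fderiv ℝ f x‖ ≤ m / 4 ∧ ‖ν y - ν x‖ ≤ 1 / 2 ∧
      ρ y ≤ 1 / 16 := by
    have c1 : ContinuousAt (fderiv ℝ f) x :=
      (hf2.continuous_fderiv two_ne_zero).continuousAt
    have c2 : ContinuousAt ν x := (hνs.continuousOn).continuousAt (hU.mem_nhds hxU)
    have c3 : ContinuousAt ρ x := (hρs.continuousOn).continuousAt (hU.mem_nhds hxU)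
    have e1 := Metric.continuousAt_iff'.1 c1 (m / 4) (by positivity)
    have e2 := Metric.continuousAt_iff'.1 c2 (1 / 2) (by positivity)
    have e3 : ∀ᶠ y in 𝓝 x, ρ y < 1 / 16 := c3.eventually_lt_const (by simp [hρdef, hfx])
    filter_upwards [hU.mem_nhds hxU, e1, e2, e3] with y h1 h2 h3 h4
    rw [dist_eq_norm] at h2 h3
    exact ⟨h1, h2.le, h3.le, h4.le⟩
  obtain ⟨R, hR, hB⟩ := Metric.nhds_basis_closedBall.eventually_iff.1 ev
  have hBU : Metric.closedBall x R ⊆ U := fun y hy => (hB hy).1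
  have hcomp : IsCompact (Metric.closedBall x R) := isCompact_closedBall x R
  have hxB : x ∈ Metric.closedBall x R := Metric.mem_closedBall_self hR.le
  obtain ⟨A1, hA1⟩ := hcomp.exists_bound_of_continuousOn hgsm.continuous.continuousOn
  obtain ⟨A2, hA2⟩ := hcomp.exists_bound_of_continuousOn
    ((hhs.continuousOn_fderiv_of_isOpen hU (by norm_num)).mono hBU)
  obtain ⟨A3, hA3⟩ := hcomp.exists_bound_of_continuousOn
    ((dv_cont hU (hνs.of_le (by norm_num))).mono hBU)
  have hρ1 : ContDiffOn ℝ 1 (fderiv ℝ ρ) U := hρs.fderiv_of_isOpen hU (by norm_num)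
  obtain ⟨A4, hA4⟩ := hcomp.exists_bound_of_continuousOn
    ((hρ1.continuousOn_fderiv_of_isOpen hU (by norm_num)).mono hBU)
  have n1 : 0 ≤ A1 := (norm_nonneg _).trans (hA1 x hxB)
  have n2 : 0 ≤ A2 := (norm_nonneg _).trans (hA2 x hxB)
  have n3 : 0 ≤ A3 := (norm_nonneg _).trans (hA3 x hxB)
  have n4 : 0 ≤ A4 := (norm_nonneg _).trans (hA4 x hxB)
  have n5 : 0 ≤ 4 * A1 / m := by positivity
  have hbB : Metric.ball x (R / 2) ⊆ Metric.closedBall x R :=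
    Metric.ball_subset_closedBall.trans (Metric.closedBall_subset_closedBall (by linarith))
  have hdρ : ∀ y ∈ U, ∀ v, fderiv ℝ ρ y v = -(f y * fderiv ℝ h y v + h y * fderiv ℝ f y v) := by
    intro y hy v
    have d1 : DifferentiableAt ℝ f y := (hf2.differentiable two_ne_zero) y
    have d2 : DifferentiableAt ℝ h y :=
      (hhs.contDiffAt (hU.mem_nhds hy)).differentiableAt two_ne_zero
    have := (d1.hasFDerivAt.mul d2.hasFDerivAt).neg.fderiv
    have e : fderiv ℝ ρ y = -(f y • fderiv ℝ h y + h y • fderiv ℝ f y) := this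
    rw [e]; simp
  refine ⟨R / 2, ρ, ν, ν x, A1 * A2 + A3 + A4 + 4 * A1 / m, by positivity, by positivity,
    (hρs.of_le (by norm_num)).mono (hbB.trans hBU), (hνs.of_le (by norm_num)).mono (hbB.trans hBU),
    ?_⟩
  intro y hyb hy
  have hyB := hbB hyb
  have hyU := hBU hyB
  set A := A1 * A2 + A3 + A4 + 4 * A1 / m with hAdef
  set d := Metric.infDist y (frontier Ω) with hd
  have hρpos : 0 < ρ y := by
    have := mul_pos (neg_pos.2 (hneg y hy hyU)) (hh0 y hyU)
    simp only [hρdef]; linarith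
  have hfρ : f y = -(ρ y * ‖g y‖) := by
    simp only [hρdef]
    have := hhm y hyU
    linear_combination (- f y) * this
  have n12 : 0 ≤ A1 * A2 := by positivity
  obtain ⟨z, hz, hdz⟩ := isClosed_frontier.exists_infDist_eq_dist ⟨x, hx⟩ y
  rw [← hd] at hdz
  have hzO : z ∉ Ω := by
    rw [hΩ.frontier_eq] at hz; exact hz.2
  have hdpos : 0 < d := by
    rw [hdz]; apply dist_pos.2; rintro rfl; exact hzO hy
  have hdR : d < R / 2 := by
    calc d ≤ dist y x := Metric.infDist_le_dist_of_mem hx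
      _ < R / 2 := hyb
  have hzB : z ∈ Metric.closedBall x R := by
    rw [Metric.mem_closedBall]
    have : dist z x ≤ dist z y + dist y x := dist_triangle _ _ _
    rw [dist_comm z y, ← hdz] at this
    have h2 : dist y x < R / 2 := hyb
    linarith
  have hνx : ‖ν x‖ = 1 := hν1 x hxU
  refine ⟨hρpos, (hB hyB).2.2.2, hν1 y hyU, ?_, ?_, ?_, hdpos, ?_, ?_⟩
  · have e : ⟪ν x, ν y⟫ = 1 + ⟪ν x, ν y - ν x⟫ := by
      rw [inner_sub_right, real_inner_self_eq_norm_sq, hνx]; ring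
    have : |⟪ν x, ν y - ν x⟫| ≤ 1 / 2 := by
      calc _ ≤ ‖ν x‖ * ‖ν y - ν x‖ := abs_real_inner_le_norm _ _
        _ ≤ 1 * (1 / 2) := by rw [hνx]; gcongr; exact (hB hyB).2.2.1
        _ = 1 / 2 := by ring
    rw [e]; linarith [(abs_le.1 this).1]
  · have e : fderiv ℝ ρ y (ν y) - 1 = -(f y * fderiv ℝ h y (ν y)) := by
      rw [hdρ y hyU, hgi]
      have : ⟪g y, ν y⟫ = -(h y * ‖g y‖ ^ 2) := by
        simp only [hνdef, inner_neg_right, inner_smul_right, real_inner_self_eq_norm_sq]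
      rw [this]
      have := hhm y hyU
      linear_combination (h y * ‖g y‖ + 1) * this
    rw [e, hfρ, abs_neg, abs_mul, abs_neg, abs_mul, abs_of_pos hρpos, abs_of_nonneg (norm_nonneg _)]
    have h1 : |fderiv ℝ h y (ν y)| ≤ A2 := by
      calc |fderiv ℝ h y (ν y)| ≤ ‖fderiv ℝ h y‖ * ‖ν y‖ := (fderiv ℝ h y).le_opNorm _
        _ ≤ A2 := by rw [hν1 y hyU, mul_one]; exact hA2 y hyB
    calc ρ y * ‖g y‖ * |fderiv ℝ h y (ν y)| ≤ ρ y * A1 * A2 := by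
          gcongr; exact hA1 y hyB
      _ = (A1 * A2) * ρ y := by ring
      _ ≤ A * ρ y := by gcongr; linarith
  · calc |dv ν y| ≤ A3 := hA3 y hyB
      _ ≤ A := by linarith
  · have hfz : f z = 0 := hfront z hz (hBU hzB)
    have hρz : ρ z = 0 := by simp [hρdef, hfz]
    have hdz1 : ‖fderiv ℝ ρ z‖ ≤ 1 := by
      have e : fderiv ℝ ρ z = -(h z • fderiv ℝ f z) := by
        ext v; rw [hdρ z (hBU hzB), hfz]; simp
      rw [e, norm_neg, norm_smul, ← norm_grad, Real.norm_eq_abs, abs_of_pos (hh0 z (hBU hzB))]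
      exact (hhm z (hBU hzB)).le
    have hLip : ∀ p ∈ Metric.closedBall x R, ‖fderiv ℝ ρ p - fderiv ℝ ρ z‖ ≤ A4 * ‖p - z‖ := by
      intro p hp
      exact (convex_closedBall x R).norm_image_sub_le_of_norm_fderiv_le (𝕜 := ℝ)
        (fun q hq => (hρ1.contDiffAt (hU.mem_nhds (hBU hq))).differentiableAt one_ne_zero)
        (fun q hq => hA4 q hq) hzB hp
    have hmv := ((convex_closedBall x R).inter
      (convex_closedBall z d)).norm_image_sub_le_of_norm_fderiv_le
      (𝕜 := ℝ) (f := ρ) (C := 1 + A4 * d) (x := z) (y := y)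
      (fun q hq => (hρs.contDiffAt (hU.mem_nhds (hBU hq.1))).differentiableAt two_ne_zero)
      (fun q hq => by
        have h1 := hLip q hq.1
        have h2 : ‖q - z‖ ≤ d := by rw [← dist_eq_norm]; exact hq.2
        have h3 : ‖fderiv ℝ ρ q‖ ≤ ‖fderiv ℝ ρ z‖ + ‖fderiv ℝ ρ q - fderiv ℝ ρ z‖ := by
          have := norm_add_le (fderiv ℝ ρ z) (fderiv ℝ ρ q - fderiv ℝ ρ z)
          simpa using this
        have h4 : A4 * ‖q - z‖ ≤ A4 * d := by gcongr
        linarith)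
      ⟨hzB, Metric.mem_closedBall_self hdpos.le⟩ ⟨hyB, by rw [Metric.mem_closedBall, hdz]⟩
    rw [hρz, sub_zero, ← dist_eq_norm, ← hdz, Real.norm_eq_abs, abs_of_pos hρpos] at hmv
    calc ρ y ≤ (1 + A4 * d) * d := hmv
      _ = d * (1 + A4 * d) := by ring
      _ ≤ d * (1 + A * d) := by gcongr; linarith
  · set w := y - (d / 2) • ν x with hw
    have hwy : dist y w = d / 2 := by
      rw [dist_eq_norm, hw, sub_sub_cancel, norm_smul, hνx, Real.norm_eq_abs,
        abs_of_pos (by positivity)]; ring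
    have hwO : w ∈ Ω := by
      by_contra hwn
      have := infDist_le_of_notMem hy hwn
      rw [hwy, ← hd] at this
      linarith
    have hwB : w ∈ Metric.closedBall x R := by
      rw [Metric.mem_closedBall]
      have : dist w x ≤ dist w y + dist y x := dist_triangle _ _ _
      rw [dist_comm w y, hwy] at this
      have h2 : dist y x < R / 2 := hyb
      linarith
    have hfw := hneg w hwO (hBU hwB)
    have hmv := (convex_closedBall x R).norm_image_sub_le_of_norm_fderiv_le' (𝕜 := ℝ) (f := f)
      (φ := fderiv ℝ f x) (C := m / 4) (x := y) (y := w)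
      (fun q _ => (hf2.differentiable two_ne_zero) q) (fun q hq => (hB hq).2.1) hyB hwB
    have e1 : w - y = -((d / 2) • ν x) := by rw [hw]; abel
    have e2 : fderiv ℝ f x (w - y) = d / 2 * m := by
      rw [e1, hgi, inner_neg_right, inner_smul_right]
      have : ⟪g x, ν x⟫ = -(h x * ‖g x‖ ^ 2) := by
        simp only [hνdef, inner_neg_right, inner_smul_right, real_inner_self_eq_norm_sq]
      rw [this]
      have := hhm x hxU
      rw [← hmdef] at this ⊢
      linear_combination (d / 2 * m) * this
    rw [e2, ← dist_eq_norm w y, dist_comm, hwy, Real.norm_eq_abs] at hmv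
    have h1 := (abs_le.1 hmv).1
    have h2 : ρ y * ‖g y‖ ≤ ρ y * A1 := by gcongr; exact hA1 y hyB
    have h3 : d * m ≤ 4 * A1 * ρ y := by nlinarith
    have h4 : d ≤ (4 * A1 / m) * ρ y := by
      rw [div_mul_eq_mul_div, le_div_iff₀ hm]; exact h3
    calc d ≤ (4 * A1 / m) * ρ y := h4
      _ ≤ A * ρ y := by gcongr; linarith
end HSM
namespace HSM

open scoped RealInnerProductSpace

lemma psi_deriv {t : ℝ} (ht : 0 < t) :
    HasDerivAt (fun s : ℝ => 1 / 2 * s⁻¹ - (√s)⁻¹)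
      (-((√t)⁻¹) ^ 4 / 2 + ((√t)⁻¹) ^ 3 / 2) t := by
  have h1 := ((hasDerivAt_inv ht.ne').const_mul (1 / 2 : ℝ)).sub
    ((Real.hasDerivAt_sqrt ht.ne').inv (Real.sqrt_pos.2 ht).ne')
  refine h1.congr_deriv ?_
  have hs : 0 < √t := Real.sqrt_pos.2 ht
  have e : t = √t ^ 2 := (Real.sq_sqrt ht.le).symm
  set a := √t
  rw [e]
  field_simp
  ring

/-- Local data near a point of the closure. -/
lemma localField {N : ℕ} {Ω : Set (Euc N)} (hΩ : IsOpen Ω) (hsm : HasSmoothBoundary Ω) {x : Euc N}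
    (hx : x ∈ closure Ω) :
    ∃ (U : Set (Euc N)) (F : Euc N → Euc N) (n : Euc N), IsOpen U ∧ x ∈ U ∧
      ContDiffOn ℝ 1 F Ω ∧
      (∃ C : ℝ, 0 ≤ C ∧ ∀ y ∈ U, y ∈ Ω → ‖F y‖ ≤ C * ⟪n, F y⟫ + C) ∧
      (∃ C : ℝ, 0 ≤ C ∧ ∀ y ∈ U, y ∈ Ω → ‖F y‖ ≤ C * dinv Ω y + C) ∧
      (∀ K : ℝ, 0 ≤ K → ∃ C : ℝ, 0 ≤ C ∧ ∀ y ∈ U, y ∈ Ω →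
        ‖F y‖ ^ 2 + dv F y + K * dinv Ω y + dinv Ω y ^ 2 / 4 ≤ C) := by
  by_cases hxΩ : x ∈ Ω
  · have hc : ContinuousAt (dinv Ω) x := (dinv_cont hΩ).continuousAt (hΩ.mem_nhds hxΩ)
    have ev : ∀ᶠ y in 𝓝 x, dinv Ω y < dinv Ω x + 1 := hc.eventually_lt_const (by linarith)
    obtain ⟨U, hU, hUo, hxU⟩ := mem_nhds_iff.1 ev
    refine ⟨U, fun _ => 0, 0, hUo, hxU, contDiffOn_const, ⟨0, le_rfl, by simp⟩,
      ⟨0, le_rfl, by simp⟩, ?_⟩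
    intro K hK
    have hn := dinv_nonneg Ω x
    refine ⟨K * (dinv Ω x + 1) + (dinv Ω x + 1) ^ 2 / 4, by positivity, ?_⟩
    intro y hy _
    have h1 : dinv Ω y < dinv Ω x + 1 := hU hy
    have h0 := dinv_nonneg Ω y
    have : dv (fun _ : Euc N => (0 : Euc N)) y = 0 := by simp [dv]
    rw [this, norm_zero]
    have h2 : K * dinv Ω y ≤ K * (dinv Ω x + 1) := by gcongr
    have h3 : dinv Ω y ^ 2 ≤ (dinv Ω x + 1) ^ 2 := by gcongr
    linarith
  · have hxf : x ∈ frontier Ω := by rw [hΩ.frontier_eq]; exact ⟨hx, hxΩ⟩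
    obtain ⟨r, ρ, ν, n, A, hr, hA, hρ, hν, hall⟩ := geo hΩ hsm hxf
    let η : ContDiffBump x := ⟨r / 2, 3 * r / 4, by positivity, by linarith⟩
    let ψ : ℝ → ℝ := fun s => 1 / 2 * s⁻¹ - (√s)⁻¹
    let F0 : Euc N → Euc N := fun y => ψ (ρ y) • ν y
    have hsub : Metric.ball x (r / 2) ⊆ Metric.ball x r := Metric.ball_subset_ball (by linarith)
    have hbo : ∀ y ∈ Metric.ball x r, Metric.ball x r ∈ 𝓝 y := fun y hy =>
      Metric.isOpen_ball.mem_nhds hy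
    have hψs : ∀ y ∈ Metric.ball x r, y ∈ Ω → ContDiffAt ℝ 1 (fun y => ψ (ρ y)) y := by
      intro y hy hyΩ
      have hρ0 := (hall y hy hyΩ).1
      have c1 : ContDiffAt ℝ 1 ρ y := hρ.contDiffAt (hbo y hy)
      exact (contDiffAt_const.mul (c1.inv hρ0.ne')).sub
        ((c1.sqrt hρ0.ne').inv (Real.sqrt_pos.2 hρ0).ne')
    have hF0 : ∀ y ∈ Metric.ball x r, y ∈ Ω → ContDiffAt ℝ 1 F0 y := by
      intro y hy hyΩ
      exact (hψs y hy hyΩ).smul (hν.contDiffAt (hbo y hy))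
    have hloc : ∀ y ∈ Metric.ball x (r / 2), (fun y => η y • F0 y) =ᶠ[𝓝 y] F0 := by
      intro y hy
      filter_upwards [Metric.isOpen_ball.mem_nhds hy] with z hz
      rw [η.one_of_mem_closedBall (Metric.ball_subset_closedBall hz), one_smul]
    have hdvF : ∀ y ∈ Metric.ball x (r / 2), y ∈ Ω → dv (fun y => η y • F0 y) y =
        ψ (ρ y) * dv ν y + (-((√(ρ y))⁻¹) ^ 4 / 2 + ((√(ρ y))⁻¹) ^ 3 / 2) *
          fderiv ℝ ρ y (ν y) := by
      intro y hy hyΩ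
      have hy' := hsub hy
      rw [dv_congr (hloc y hy)]
      rw [dv_smul ((hψs y hy' hyΩ).differentiableAt one_ne_zero)
        ((hν.contDiffAt (hbo y hy')).differentiableAt one_ne_zero)]
      have hd := (psi_deriv (hall y hy' hyΩ).1).comp_hasFDerivAt y
        ((hρ.contDiffAt (hbo y hy')).differentiableAt one_ne_zero).hasFDerivAt
      have e : fderiv ℝ (fun y => ψ (ρ y)) y = _ := hd.fderiv
      rw [e]; simp
    -- numerical facts
    have hnum : ∀ y ∈ Metric.ball x (r / 2), y ∈ Ω → 4 ≤ (√(ρ y))⁻¹ ∧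
        ((√(ρ y))⁻¹ ^ 2)⁻¹ = ρ y ∧ ψ (ρ y) = (√(ρ y))⁻¹ ^ 2 / 2 - (√(ρ y))⁻¹ := by
      intro y hy hyΩ
      obtain ⟨h0, h16, -⟩ := hall y (hsub hy) hyΩ
      have hs : 0 < √(ρ y) := Real.sqrt_pos.2 h0
      have hsq := Real.sq_sqrt h0.le
      have hle : √(ρ y) ≤ 1 / 4 := by
        rw [Real.sqrt_le_left (by norm_num)]; norm_num; linarith
      refine ⟨?_, ?_, ?_⟩
      · rw [le_inv_comm₀ (by norm_num) hs]; linarith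
      · rw [inv_pow, inv_inv, hsq]
      · simp only [ψ]; rw [inv_pow, hsq]; ring
    have hFval : ∀ y ∈ Metric.ball x (r / 2), η y • F0 y = ψ (ρ y) • ν y := by
      intro y hy
      exact (hloc y hy).eq_of_nhds
    have hFnorm : ∀ y ∈ Metric.ball x (r / 2), y ∈ Ω → ‖η y • F0 y‖ = ψ (ρ y) ∧ 0 ≤ ψ (ρ y) := by
      intro y hy hyΩ
      obtain ⟨h4, -, hψ⟩ := hnum y hy hyΩ
      have : 0 ≤ ψ (ρ y) := by rw [hψ]; nlinarith
      rw [hFval y hy, norm_smul, (hall y (hsub hy) hyΩ).2.2.1, mul_one, Real.norm_eq_abs,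
        abs_of_nonneg this]
      exact ⟨rfl, this⟩
    refine ⟨Metric.ball x (r / 2), fun y => η y • F0 y, n, Metric.isOpen_ball,
      Metric.mem_ball_self (by positivity), ?_, ⟨2, by norm_num, ?_⟩, ⟨A, hA, ?_⟩, ?_⟩
    · intro y hy
      apply ContDiffAt.contDiffWithinAt
      by_cases hyb : y ∈ Metric.ball x r
      · exact η.contDiff.contDiffAt.smul (hF0 y hyb hy)
      · have hns : y ∉ tsupport η := by
          rw [η.tsupport_eq]
          intro h
          apply hyb
          have : dist y x ≤ 3 * r / 4 := h
          rw [Metric.mem_ball]; linarith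
        have : (fun y => η y • F0 y) =ᶠ[𝓝 y] fun _ => 0 := by
          filter_upwards [notMem_tsupport_iff_eventuallyEq.1 hns] with z hz
          simp [hz]
        exact contDiffAt_const.congr_of_eventuallyEq this
    · intro y hy hyΩ
      obtain ⟨e, h0⟩ := hFnorm y hy hyΩ
      show ‖η y • F0 y‖ ≤ 2 * ⟪n, η y • F0 y⟫ + 2
      rw [e, hFval y hy, inner_smul_right]
      have := (hall y (hsub hy) hyΩ).2.2.2.1
      nlinarith
    · intro y hy hyΩ
      obtain ⟨e, h0⟩ := hFnorm y hy hyΩ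
      show ‖η y • F0 y‖ ≤ _
      rw [e]
      obtain ⟨h4, hi, hψ⟩ := hnum y hy hyΩ
      obtain ⟨hρ0, -, -, -, -, -, hd0, -, hdA⟩ := hall y (hsub hy) hyΩ
      have h1 : ψ (ρ y) ≤ (ρ y)⁻¹ := by
        have hj := congrArg Inv.inv hi
        rw [inv_inv] at hj
        rw [hψ, ← hj]; nlinarith
      have h2 : (ρ y)⁻¹ ≤ A * dinv Ω y := by
        unfold dinv
        rw [← div_eq_mul_inv, le_div_iff₀ hd0, inv_mul_le_iff₀ hρ0, mul_comm]
        exact hdA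
      linarith
    · intro K hK
      refine ⟨4 * (1 + 2 * A + K + A ^ 2 / 2) ^ 3 + K * A ^ 2 + A ^ 4 / 4, by positivity, ?_⟩
      intro y hy hyΩ
      obtain ⟨e, h0⟩ := hFnorm y hy hyΩ
      show ‖η y • F0 y‖ ^ 2 + _ + _ + _ ≤ _
      rw [e, hdvF y hy hyΩ]
      obtain ⟨h4, hi, hψ⟩ := hnum y hy hyΩ
      obtain ⟨hρ0, -, -, -, hp, hq, hd0, hρd, hdA⟩ := hall y (hsub hy) hyΩ
      rw [← hi] at hp hρd hdA
      have := calc1 (D := dinv Ω y) hA hK (by linarith) hd0 rfl hρd hdA hp hq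
      rw [hψ]
      linarith
end HSM
namespace HSM

open scoped RealInnerProductSpace

lemma partition {N : ℕ} {Ω : Set (Euc N)} (hΩ : IsOpen Ω) (hb : Bornology.IsBounded Ω)
    (hsm : HasSmoothBoundary Ω) :
    ∃ (ι : Type) (_ : Fintype ι) (χ : ι → Euc N → ℝ) (F : ι → Euc N → Euc N) (n : ι → Euc N)
      (C : ℝ), 0 ≤ C ∧ (∀ i, ContDiff ℝ 1 (χ i)) ∧ (∀ i x, 0 ≤ χ i x) ∧
      (∀ x ∈ Ω, ∑ i, χ i x = 1) ∧ (∀ i, ContDiffOn ℝ 1 (F i) Ω) ∧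
      (∀ i, ∀ y ∈ Ω, χ i y * ‖F i y‖ ≤ χ i y * ⟪n i, F i y⟫ + C) ∧
      (∀ i, ∀ y ∈ Ω, |fderiv ℝ (χ i) y (n i)| ≤ C) ∧
      (∀ y ∈ Ω, ∑ i, (χ i y * ‖F i y‖ ^ 2 + dv (fun z => χ i z • F i z) y)
        + dinv Ω y ^ 2 / 4 ≤ C) := by
  classical
  have hcl : IsCompact (closure Ω) := hb.isCompact_closure
  choose! U F n hUo hxU hF hF1 hF2 hF3 using
    (fun (x : Euc N) (hx : x ∈ closure Ω) => localField hΩ hsm hx)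
  obtain ⟨t, ht1, ht2⟩ := hcl.elim_nhds_subcover U
    (fun x hx => (hUo x hx).mem_nhds (hxU x hx))
  let e := t.equivFin
  let c : Fin t.card → Euc N := fun i => (e.symm i : Euc N)
  have hc : ∀ i, c i ∈ closure Ω := fun i => ht1 _ (e.symm i).2
  obtain ⟨f, hf⟩ := SmoothPartitionOfUnity.exists_isSubordinate
    (modelWithCornersSelf ℝ (Euc N)) (s := closure Ω) isClosed_closure
    (fun i => U (c i)) (fun i => hUo _ (hc i)) (by
      intro x hx
      obtain ⟨y, hy, hxy⟩ := Set.mem_iUnion₂.1 (ht2 hx)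
      exact Set.mem_iUnion.2 ⟨e ⟨y, hy⟩, by simpa [c] using hxy⟩)
  have hχ : ∀ i, ContDiff ℝ 1 (f i) := fun i => by
    have := (f i).contMDiff.contDiff
    exact this.of_le (by exact_mod_cast le_top)
  choose C1 hC1 hF1 using (fun i => hF1 (c i) (hc i))
  choose C2 hC2 hF2 using (fun i => hF2 (c i) (hc i))
  have hG : ∀ i, ∃ G : ℝ, 0 ≤ G ∧ ∀ y ∈ Ω, ‖fderiv ℝ (f i) y‖ ≤ G := by
    intro i
    obtain ⟨G, hG⟩ := hcl.exists_bound_of_continuousOn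
      ((hχ i).continuous_fderiv one_ne_zero).continuousOn
    exact ⟨|G|, abs_nonneg _, fun y hy => (hG y (subset_closure hy)).trans (le_abs_self _)⟩
  choose G hG0 hG using hG
  let K : ℝ := ∑ i, G i * C2 i
  have hK : 0 ≤ K := Finset.sum_nonneg fun i _ => mul_nonneg (hG0 i) (hC2 i)
  choose C3 hC3 hF3 using (fun i => hF3 (c i) (hc i) K hK)
  have hsum : ∀ x ∈ Ω, ∑ i, f i x = 1 := by
    intro x hx
    have := f.sum_eq_one (subset_closure hx)
    rwa [finsum_eq_sum_of_fintype] at this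
  have hmem : ∀ i y, y ∉ U (c i) → f i y = 0 ∧ fderiv ℝ (f i) y = 0 := by
    intro i y hy
    have hns : y ∉ tsupport (f i) := fun h => hy (hf i h)
    refine ⟨image_eq_zero_of_notMem_tsupport hns, ?_⟩
    have := notMem_tsupport_iff_eventuallyEq.1 hns
    rw [this.fderiv_eq]; simp
  let S1 : ℝ := ∑ i, C1 i
  let S2 : ℝ := ∑ i, G i * ‖C1 i • n (c i)‖
  let S3 : ℝ := ∑ i, C3 i
  have h1 : 0 ≤ S1 := Finset.sum_nonneg fun i _ => hC1 i
  have h2 : 0 ≤ S2 := Finset.sum_nonneg fun i _ => mul_nonneg (hG0 i) (norm_nonneg _)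
  have h3 : 0 ≤ S3 := Finset.sum_nonneg fun i _ => hC3 i
  have le1 : ∀ i, C1 i ≤ S1 := fun i =>
    Finset.single_le_sum (f := C1) (fun i _ => hC1 i) (Finset.mem_univ i)
  have le2 : ∀ i, G i * ‖C1 i • n (c i)‖ ≤ S2 := fun i =>
    Finset.single_le_sum (f := fun i => G i * ‖C1 i • n (c i)‖)
      (fun i _ => mul_nonneg (hG0 i) (norm_nonneg _)) (Finset.mem_univ i)
  have le3 : ∀ i, C3 i ≤ S3 := fun i =>
    Finset.single_le_sum (f := C3) (fun i _ => hC3 i) (Finset.mem_univ i)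
  refine ⟨Fin t.card, inferInstance, fun i => f i, fun i => F (c i), fun i => C1 i • n (c i),
    S1 + S2 + S3 + K, by positivity, hχ, fun i x => f.nonneg i x, hsum,
    fun i => hF (c i) (hc i), ?_, ?_, ?_⟩
  · intro i y hy
    by_cases hyU : y ∈ U (c i)
    · have a1 := hF1 i y hyU hy
      have a2 := f.nonneg i y
      have a3 := f.le_one i y
      have a4 := mul_le_mul_of_nonneg_left a1 a2
      have a5 : f i y * C1 i ≤ 1 * C1 i := by
        gcongr; exact hC1 i
      rw [real_inner_smul_left]
      have := le1 i
      show f i y * ‖F (c i) y‖ ≤ f i y * (C1 i * ⟪n (c i), F (c i) y⟫) + (S1 + S2 + S3 + K)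
      linarith
    · have := (hmem i y hyU).1
      simp only [this]
      simp; positivity
  · intro i y hy
    calc |fderiv ℝ (f i) y (C1 i • n (c i))| ≤ ‖fderiv ℝ (f i) y‖ * ‖C1 i • n (c i)‖ :=
          (fderiv ℝ (f i) y).le_opNorm _
      _ ≤ G i * ‖C1 i • n (c i)‖ := by gcongr; exact hG i y hy
      _ ≤ S2 := le2 i
      _ ≤ _ := by linarith
  · intro y hy
    have hd := dinv_nonneg Ω y
    have hterm : ∀ i, f i y * ‖F (c i) y‖ ^ 2 + dv (fun z => f i z • F (c i) z) y ≤
        f i y * (S3 - K * dinv Ω y - dinv Ω y ^ 2 / 4) + G i * C2 i * (dinv Ω y + 1) := by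
      intro i
      rw [dv_smul (((hχ i).differentiable one_ne_zero) y)
        (((hF (c i) (hc i)).contDiffAt (hΩ.mem_nhds hy)).differentiableAt one_ne_zero)]
      by_cases hyU : y ∈ U (c i)
      · have a1 := hF3 i y hyU hy
        have a2 := f.nonneg i y
        have a3 := hF2 i y hyU hy
        have a4 : fderiv ℝ (f i) y (F (c i) y) ≤ G i * C2 i * (dinv Ω y + 1) := by
          calc fderiv ℝ (f i) y (F (c i) y) ≤ |fderiv ℝ (f i) y (F (c i) y)| := le_abs_self _
            _ ≤ ‖fderiv ℝ (f i) y‖ * ‖F (c i) y‖ := (fderiv ℝ (f i) y).le_opNorm _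
            _ ≤ G i * (C2 i * dinv Ω y + C2 i) := by
              gcongr
              · exact hG0 i
              · exact hG i y hy
            _ = _ := by ring
        have a5 : ‖F (c i) y‖ ^ 2 + dv (F (c i)) y ≤ S3 - K * dinv Ω y - dinv Ω y ^ 2 / 4 := by
          linarith [le3 i]
        have a6 := mul_le_mul_of_nonneg_left a5 a2
        linarith
      · obtain ⟨b1, b2⟩ := hmem i y hyU
        rw [b1, b2]
        have := mul_nonneg (mul_nonneg (hG0 i) (hC2 i)) (add_nonneg hd zero_le_one)
        simpa using this
    have hS := Finset.sum_le_sum (s := Finset.univ) (fun i _ => hterm i)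
    rw [Finset.sum_add_distrib (f := fun i => f i y * (S3 - K * dinv Ω y - dinv Ω y ^ 2 / 4)),
      ← Finset.sum_mul, ← Finset.sum_mul, hsum y hy] at hS
    have hKe : ∑ i, G i * C2 i = K := rfl
    rw [hKe] at hS
    show ∑ i, (f i y * ‖F (c i) y‖ ^ 2 + dv (fun z => f i z • F (c i) z) y) + dinv Ω y ^ 2 / 4 ≤ _
    linarith

end HSM
namespace HSM

open scoped RealInnerProductSpace

lemma abs_rpow_mul_self {a s : ℝ} (hs : 1 < s) : |a| ^ (s - 2) * a * a = |a| ^ s := by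
  rcases eq_or_ne a 0 with rfl | h
  · simp [Real.zero_rpow (show s ≠ 0 by linarith)]
  · have : 0 < |a| := abs_pos.2 h
    rw [mul_assoc, ← abs_mul_abs_self, ← sq, ← Real.rpow_natCast, ← Real.rpow_add this]
    congr 1; norm_num

lemma abs_rpow_mul_abs {a s : ℝ} (hs : 1 < s) : |a| ^ (s - 2) * |a| = |a| ^ (s - 1) := by
  rcases eq_or_ne a 0 with rfl | h
  · simp [Real.zero_rpow (show s - 1 ≠ 0 by linarith)]
  · have : 0 < |a| := abs_pos.2 h
    rw [← Real.rpow_add_one this.ne']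
    congr 1; ring

lemma young {a b t : ℝ} (ht : 0 < t) : a * b ≤ t * a ^ 2 + b ^ 2 / t := by
  have h : t * a ^ 2 + b ^ 2 / t - a * b = ((t * a - b / 2) ^ 2 + 3 / 4 * b ^ 2) / t := by
    field_simp; ring
  have : 0 ≤ ((t * a - b / 2) ^ 2 + 3 / 4 * b ^ 2) / t := by positivity
  linarith

variable {N : ℕ} {Ω : Set (Euc N)}

lemma grad_cont {u : Euc N → ℝ} (hu : ContDiff ℝ 1 u) : Continuous (gradient u) :=
  (InnerProductSpace.toDual ℝ (Euc N)).symm.continuous.comp (hu.continuous_fderiv one_ne_zero)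

lemma grad_zero {u : Euc N → ℝ} {x : Euc N} (hx : x ∉ tsupport u) : gradient u x = 0 := by
  rw [← norm_eq_zero, norm_grad, norm_eq_zero]
  rw [(notMem_tsupport_iff_eventuallyEq.1 hx).fderiv_eq]; simp

lemma claimA (hΩ : IsOpen Ω) {ι : Type} [Fintype ι] {χ : ι → Euc N → ℝ} {F : ι → Euc N → Euc N}
    {C : ℝ} (hχ : ∀ i, ContDiff ℝ 1 (χ i)) (hsum : ∀ x ∈ Ω, ∑ i, χ i x = 1)
    (hF : ∀ i, ContDiffOn ℝ 1 (F i) Ω)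
    (hC : ∀ y ∈ Ω, ∑ i, (χ i y * ‖F i y‖ ^ 2 + dv (fun z => χ i z • F i z) y)
        + dinv Ω y ^ 2 / 4 ≤ C)
    {u : Euc N → ℝ} (hu : ContDiff ℝ 1 u) (hcs : HasCompactSupport u) (hs : tsupport u ⊆ Ω) :
    (∫ x in Ω, ∑ i, χ i x * ‖gradient u x - u x • F i x‖ ^ 2) ≤
      (∫ x in Ω, ‖gradient u x‖ ^ 2) - 1 / 4 * (∫ x in Ω, u x ^ 2 * dinv Ω x ^ 2) +
        C * ∫ x in Ω, u x ^ 2 := by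
  have hgc := (grad_cont hu).continuousOn (s := tsupport u)
  have huc := hu.continuous.continuousOn (s := tsupport u)
  have hFc : ∀ i, ContinuousOn (F i) (tsupport u) := fun i => (hF i).continuousOn.mono hs
  have hχc : ∀ i, ContinuousOn (χ i) (tsupport u) := fun i => (hχ i).continuous.continuousOn
  have hu0 : ∀ x, x ∉ tsupport u → u x = 0 := fun x hx => image_eq_zero_of_notMem_tsupport hx
  have hg0 : ∀ x, x ∉ tsupport u → gradient u x = 0 := fun x hx => grad_zero hx
  have hV : ∀ i, ContDiffOn ℝ 1 (fun z => χ i z • F i z) Ω := fun i =>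
    (hχ i).contDiffOn.smul (hF i)
  have hu2 : ContDiff ℝ 1 (fun x => u x ^ 2) := hu.pow 2
  have hts : tsupport (fun x => u x ^ 2) ⊆ tsupport u :=
    closure_mono (fun x hx => by
      simp only [Function.mem_support] at hx ⊢
      exact fun h => hx (by rw [h]; ring))
  have hcs2 : HasCompactSupport (fun x => u x ^ 2) := hcs.mono' (subset_closure.trans hts)
  have hibp : ∀ i, ∫ x in Ω, (u x ^ 2 * dv (fun z => χ i z • F i z) x +
      fderiv ℝ (fun x => u x ^ 2) x (χ i x • F i x)) = 0 := fun i =>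
    ibp hΩ hu2 hcs2 (hts.trans hs) (hV i)
  have hdu2 : ∀ x v, fderiv ℝ (fun x => u x ^ 2) x v = 2 * u x * ⟪gradient u x, v⟫ := by
    intro x v
    rw [inner_gradient_left]
    have := ((hu.differentiable one_ne_zero) x).hasFDerivAt.pow 2
    have e := this.fderiv
    rw [e]; simp
  have I1 : IntegrableOn (fun x => ∑ i, χ i x * ‖gradient u x - u x • F i x‖ ^ 2) Ω := by
    apply intg hcs
    · fun_prop
    · intro x hx; simp [hu0 x hx, hg0 x hx]
  have I2 : IntegrableOn (fun x => ‖gradient u x‖ ^ 2) Ω := by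
    apply intg hcs
    · fun_prop
    · intro x hx; simp [hg0 x hx]
  have I3 : IntegrableOn (fun x => u x ^ 2 * dinv Ω x ^ 2) Ω := by
    have := (dinv_cont hΩ).mono hs
    apply intg hcs
    · fun_prop
    · intro x hx; simp [hu0 x hx]
  have I4 : IntegrableOn (fun x => u x ^ 2) Ω := by
    apply intg hcs
    · fun_prop
    · intro x hx; simp [hu0 x hx]
  have I5 : ∀ i, IntegrableOn (fun x => u x ^ 2 * dv (fun z => χ i z • F i z) x +
      fderiv ℝ (fun x => u x ^ 2) x (χ i x • F i x)) Ω := by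
    intro i
    have h1 := (dv_cont hΩ (hV i)).mono hs
    have h2 : ContinuousOn (fderiv ℝ (fun x => u x ^ 2)) (tsupport u) :=
      (hu2.continuous_fderiv one_ne_zero).continuousOn
    have h3 := hFc i
    have h4 := hχc i
    apply intg hcs
    · fun_prop
    · intro x hx; rw [hdu2]; simp [hu0 x hx]
  have I5s := integrable_finsetSum (μ := volume.restrict Ω) Finset.univ (fun i _ => I5 i)
  have hpt : ∀ x ∈ Ω, ∑ i, χ i x * ‖gradient u x - u x • F i x‖ ^ 2 ≤
      ‖gradient u x‖ ^ 2 - 1 / 4 * (u x ^ 2 * dinv Ω x ^ 2) + C * u x ^ 2 -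
      ∑ i, (u x ^ 2 * dv (fun z => χ i z • F i z) x +
      fderiv ℝ (fun x => u x ^ 2) x (χ i x • F i x)) := by
    intro x hx
    have e : ∀ i, χ i x * ‖gradient u x - u x • F i x‖ ^ 2 =
        χ i x * ‖gradient u x‖ ^ 2 - (u x ^ 2 * dv (fun z => χ i z • F i z) x +
          fderiv ℝ (fun x => u x ^ 2) x (χ i x • F i x)) +
        u x ^ 2 * (χ i x * ‖F i x‖ ^ 2 + dv (fun z => χ i z • F i z) x) := by
      intro i
      rw [norm_sub_sq_real, hdu2, inner_smul_right, inner_smul_right, norm_smul, mul_pow,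
        Real.norm_eq_abs, sq_abs]
      ring
    rw [Finset.sum_congr rfl (fun i _ => e i), Finset.sum_add_distrib, Finset.sum_sub_distrib,
      ← Finset.sum_mul, hsum x hx, ← Finset.mul_sum]
    have := mul_le_mul_of_nonneg_left (hC x hx) (sq_nonneg (u x))
    linarith
  have J1 : IntegrableOn (fun x => ‖gradient u x‖ ^ 2 - 1 / 4 * (u x ^ 2 * dinv Ω x ^ 2)) Ω :=
    I2.sub (I3.const_mul _)
  have J2 : IntegrableOn (fun x => ‖gradient u x‖ ^ 2 - 1 / 4 * (u x ^ 2 * dinv Ω x ^ 2)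
      + C * u x ^ 2) Ω := J1.add (I4.const_mul _)
  calc _ ≤ ∫ x in Ω, (‖gradient u x‖ ^ 2 - 1 / 4 * (u x ^ 2 * dinv Ω x ^ 2) + C * u x ^ 2 -
      ∑ i, (u x ^ 2 * dv (fun z => χ i z • F i z) x +
      fderiv ℝ (fun x => u x ^ 2) x (χ i x • F i x))) :=
        setIntegral_mono_on I1 (J2.sub I5s) hΩ.measurableSet hpt
    _ = _ := by
      rw [integral_sub J2 I5s, integral_add J1 (I4.const_mul _),
        integral_sub I2 (I3.const_mul _), integral_const_mul, integral_const_mul,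
        integral_finsetSum _ (fun i _ => I5 i)]
      simp only [hibp, Finset.sum_const_zero, sub_zero]

lemma claimB (hΩ : IsOpen Ω) {ι : Type} [Fintype ι] {χ : ι → Euc N → ℝ} {F : ι → Euc N → Euc N}
    {n : ι → Euc N} {C s : ℝ} (h1s : 2 < s) (hC0 : 0 ≤ C)
    (hχ : ∀ i, ContDiff ℝ 1 (χ i)) (hχ0 : ∀ i x, 0 ≤ χ i x)
    (hsum : ∀ x ∈ Ω, ∑ i, χ i x = 1)
    (hF : ∀ i, ContDiffOn ℝ 1 (F i) Ω)
    (hC1 : ∀ i, ∀ y ∈ Ω, χ i y * ‖F i y‖ ≤ χ i y * ⟪n i, F i y⟫ + C)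
    (hC2 : ∀ i, ∀ y ∈ Ω, |fderiv ℝ (χ i) y (n i)| ≤ C) :
    ∃ B : ℝ, 0 < B ∧ ∀ u : Euc N → ℝ, ContDiff ℝ 1 u → HasCompactSupport u → tsupport u ⊆ Ω →
      ∀ t : ℝ, 0 < t → (∫ x in Ω, ‖fderiv ℝ (fun y => |u y| ^ s) x‖) ≤
        B * (t * (∫ x in Ω, |u x| ^ (2 * (s - 1))) +
          ((∫ x in Ω, ∑ i, χ i x * ‖gradient u x - u x • F i x‖ ^ 2) +
            ∫ x in Ω, u x ^ 2) / t) := by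
  set B1 : ℝ := s * (1 + ∑ i, ‖n i‖) with hB1
  set B2 : ℝ := (Fintype.card ι : ℝ) * (C + s * C) with hB2
  have hn0 : 0 ≤ ∑ i, ‖n i‖ := Finset.sum_nonneg fun i _ => norm_nonneg _
  have hB10 : 0 < B1 := by positivity
  have hB20 : 0 ≤ B2 := by positivity
  refine ⟨B1 + B2, by positivity, ?_⟩
  intro u hu hcs hs t ht
  have hgc := (grad_cont hu).continuousOn (s := tsupport u)
  have huc := hu.continuous.continuousOn (s := tsupport u)
  have hFc : ∀ i, ContinuousOn (F i) (tsupport u) := fun i => (hF i).continuousOn.mono hs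
  have hχc : ∀ i, ContinuousOn (χ i) (tsupport u) := fun i => (hχ i).continuous.continuousOn
  have hu0 : ∀ x, x ∉ tsupport u → u x = 0 := fun x hx => image_eq_zero_of_notMem_tsupport hx
  have hg0 : ∀ x, x ∉ tsupport u → gradient u x = 0 := fun x hx => grad_zero hx
  have hw : ContDiff ℝ 1 (fun x => |u x| ^ s) := by
    simpa using hu.norm_rpow (p := s) (by linarith)
  have hts : tsupport (fun x => |u x| ^ s) ⊆ tsupport u :=
    closure_mono (fun x hx => by
      simp only [Function.mem_support] at hx ⊢
      exact fun h => hx (by rw [h, abs_zero, Real.zero_rpow (by linarith)]))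
  have hcsw : HasCompactSupport (fun x => |u x| ^ s) := hcs.mono' (subset_closure.trans hts)
  have hdw : ∀ x v, fderiv ℝ (fun x => |u x| ^ s) x v =
      s * |u x| ^ (s - 2) * u x * ⟪gradient u x, v⟫ := by
    intro x v
    rw [inner_gradient_left]
    have := (hasDerivAt_abs_rpow (u x) (p := s) (by linarith)).comp_hasFDerivAt x
      ((hu.differentiable one_ne_zero) x).hasFDerivAt
    have e : fderiv ℝ (fun x => |u x| ^ s) x = _ := this.fderiv
    rw [e]; simp
  have hdwn : ∀ x, ‖fderiv ℝ (fun x => |u x| ^ s) x‖ ≤ s * |u x| ^ (s - 1) * ‖gradient u x‖ := by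
    intro x
    have h0 : 0 ≤ |u x| ^ (s - 1) := by positivity
    refine ContinuousLinearMap.opNorm_le_bound _ (by positivity) (fun v => ?_)
    rw [hdw, ← abs_rpow_mul_abs (show 1 < s by linarith), norm_mul, Real.norm_eq_abs, abs_mul,
      abs_of_nonneg (show 0 ≤ s * |u x| ^ (s - 2) by positivity)]
    calc _ ≤ s * |u x| ^ (s - 2) * |u x| * (‖gradient u x‖ * ‖v‖) := by
          gcongr; exact norm_inner_le_norm _ _
      _ = _ := by ring
  have hVs : ∀ i, ContDiffOn ℝ 1 (fun z => χ i z • n i) Ω := fun i =>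
    ((hχ i).smul contDiff_const).contDiffOn
  have hdvV : ∀ i x, dv (fun z => χ i z • n i) x = fderiv ℝ (χ i) x (n i) := by
    intro i x
    rw [dv_smul (((hχ i).differentiable one_ne_zero) x) (differentiableAt_const _)]
    simp [dv]
  set br : ι → Euc N → ℝ := fun i x => |u x| ^ s * dv (fun z => χ i z • n i) x +
      fderiv ℝ (fun x => |u x| ^ s) x (χ i x • n i) with hbr
  have hibp : ∀ i, ∫ x in Ω, br i x = 0 := fun i =>
    ibp hΩ hw hcsw (hts.trans hs) (hVs i)
  have I1 : IntegrableOn (fun x => ∑ i, χ i x * ‖gradient u x - u x • F i x‖ ^ 2) Ω := by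
    apply intg hcs
    · fun_prop
    · intro x hx; simp [hu0 x hx, hg0 x hx]
  have I2 : IntegrableOn (fun x => |u x| ^ (2 * (s - 1))) Ω := by
    apply intg hcs
    · exact ContinuousOn.rpow_const (by fun_prop) (fun x _ => Or.inr (by linarith))
    · intro x hx; rw [hu0 x hx, abs_zero, Real.zero_rpow (by linarith)]
  have I4 : IntegrableOn (fun x => u x ^ 2) Ω := by
    apply intg hcs
    · fun_prop
    · intro x hx; simp [hu0 x hx]
  have I0 : IntegrableOn (fun x => ‖fderiv ℝ (fun y => |u y| ^ s) x‖) Ω := by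
    have h2 : ContinuousOn (fderiv ℝ (fun x => |u x| ^ s)) (tsupport u) :=
      (hw.continuous_fderiv one_ne_zero).continuousOn
    apply intg hcs
    · fun_prop
    · intro x hx
      apply le_antisymm _ (norm_nonneg _)
      refine (hdwn x).trans ?_
      simp [hg0 x hx]
  have I5 : ∀ i, IntegrableOn (br i) Ω := by
    intro i
    have h1 := (dv_cont hΩ (hVs i)).mono hs
    have h2 : ContinuousOn (fderiv ℝ (fun x => |u x| ^ s)) (tsupport u) :=
      (hw.continuous_fderiv one_ne_zero).continuousOn
    have h3 := hw.continuous.continuousOn (s := tsupport u)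
    have h4 := hχc i
    apply intg hcs
    · simp only [hbr]; fun_prop
    · intro x hx; simp only [hbr]; rw [hdw, hu0 x hx, abs_zero, Real.zero_rpow (by linarith)]; simp
  have I5s := integrable_finsetSum (μ := volume.restrict Ω) Finset.univ (fun i _ => I5 i)
  have hpt : ∀ x ∈ Ω, ‖fderiv ℝ (fun y => |u y| ^ s) x‖ ≤
      (B1 + B2) * (t * |u x| ^ (2 * (s - 1)) +
        ((∑ i, χ i x * ‖gradient u x - u x • F i x‖ ^ 2) + u x ^ 2) / t) + ∑ i, br i x := by
    intro x hx
    set P := |u x| ^ (s - 1) with hP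
    have hP0 : 0 ≤ P := by positivity
    have hP2 : |u x| ^ (2 * (s - 1)) = P ^ 2 := by
      rw [hP, ← Real.rpow_natCast, ← Real.rpow_mul (abs_nonneg _)]; congr 1; push_cast; ring
    have hPs : |u x| ^ s = P * |u x| := by
      rcases eq_or_ne (u x) 0 with h | h
      · rw [h, abs_zero, Real.zero_rpow (by linarith)]; simp
      · rw [hP, ← Real.rpow_add_one (abs_pos.2 h).ne']; congr 1; ring
    set g : ι → Euc N := fun i => gradient u x - u x • F i x with hg
    have hgrad : ∀ i, gradient u x = g i + u x • F i x := fun i => by simp [hg]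
    set Z := t * P ^ 2 + u x ^ 2 / t with hZ
    have hus : |u x| ^ s ≤ Z := by
      rw [hPs]
      have := young (a := P) (b := |u x|) ht
      rwa [sq_abs] at this
    have hus0 : 0 ≤ |u x| ^ s := by positivity
    -- chartwise estimate
    have hch : ∀ i, s * P * (χ i x * ‖gradient u x‖) ≤
        B1 * (χ i x * (t * P ^ 2 + ‖g i‖ ^ 2 / t)) + (C + s * C) * Z + br i x := by
      intro i
      have hχi := hχ0 i x
      have a1 : ‖gradient u x‖ ≤ ‖g i‖ + |u x| * ‖F i x‖ := by
        rw [hgrad i]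
        refine (norm_add_le _ _).trans ?_
        rw [norm_smul, Real.norm_eq_abs]
      have a2 : s * P * (χ i x * ‖gradient u x‖) ≤
          s * (χ i x * (P * ‖g i‖)) + s * |u x| ^ s * (χ i x * ‖F i x‖) := by
        rw [hPs]
        calc _ ≤ s * P * (χ i x * (‖g i‖ + |u x| * ‖F i x‖)) := by gcongr
          _ = _ := by ring
      have a3 := mul_le_mul_of_nonneg_left (hC1 i x hx)
        (show 0 ≤ s * |u x| ^ s by positivity)
      have a4 : br i x = |u x| ^ s * fderiv ℝ (χ i) x (n i) +
          s * |u x| ^ (s - 2) * u x * (χ i x * ⟪g i, n i⟫) +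
          s * |u x| ^ s * (χ i x * ⟪n i, F i x⟫) := by
        simp only [hbr]
        rw [hdvV, hdw, ← abs_rpow_mul_self (show 1 < s by linarith)]
        conv_lhs => rw [hgrad i]
        rw [inner_smul_right, inner_add_left, real_inner_smul_left, real_inner_comm (n i) (F i x)]
        ring
      have a5 : |(|u x| ^ s * fderiv ℝ (χ i) x (n i))| ≤ |u x| ^ s * C := by
        rw [abs_mul, abs_of_nonneg hus0]; gcongr; exact hC2 i x hx
      have a6 : |s * |u x| ^ (s - 2) * u x * (χ i x * ⟪g i, n i⟫)| ≤
          s * ‖n i‖ * (χ i x * (P * ‖g i‖)) := by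
        rw [abs_mul, abs_mul, abs_of_nonneg (show 0 ≤ s * |u x| ^ (s - 2) by positivity),
          abs_mul, abs_of_nonneg hχi, mul_assoc s, abs_rpow_mul_abs (show 1 < s by linarith)]
        calc _ ≤ s * P * (χ i x * (‖g i‖ * ‖n i‖)) := by
              gcongr; exact abs_real_inner_le_norm _ _
          _ = _ := by ring
      have a7 : s + s * ‖n i‖ ≤ B1 := by
        have : ‖n i‖ ≤ ∑ i, ‖n i‖ :=
          Finset.single_le_sum (f := fun i => ‖n i‖) (fun i _ => norm_nonneg _) (Finset.mem_univ i)
        rw [hB1]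
        have := mul_le_mul_of_nonneg_left this (show 0 ≤ s by linarith)
        linarith
      have a8 : (s + s * ‖n i‖) * (χ i x * (P * ‖g i‖)) ≤
          B1 * (χ i x * (t * P ^ 2 + ‖g i‖ ^ 2 / t)) := by
        have hy := young (a := P) (b := ‖g i‖) ht
        gcongr
      have a9 : (C + s * C) * |u x| ^ s ≤ (C + s * C) * Z := by
        have : 0 ≤ C + s * C := by positivity
        gcongr
      have b5 := (abs_le.1 a5).1
      have b6 := (abs_le.1 a6).1
      linarith
    have hS := Finset.sum_le_sum (s := Finset.univ) (fun i _ => hch i)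
    rw [← Finset.mul_sum, ← Finset.sum_mul, hsum x hx, one_mul, Finset.sum_add_distrib,
      Finset.sum_add_distrib, ← Finset.mul_sum, Finset.sum_const, Finset.card_univ,
      nsmul_eq_mul] at hS
    have e1 : ∑ i, χ i x * (t * P ^ 2 + ‖g i‖ ^ 2 / t) =
        t * P ^ 2 + (∑ i, χ i x * ‖g i‖ ^ 2) / t := by
      simp only [mul_add, Finset.sum_add_distrib]
      rw [← Finset.sum_mul, hsum x hx, one_mul, Finset.sum_div]
      congr 1
      exact Finset.sum_congr rfl (fun i _ => by ring)
    rw [e1] at hS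
    have hSg : 0 ≤ ∑ i, χ i x * ‖g i‖ ^ 2 :=
      Finset.sum_nonneg fun i _ => mul_nonneg (hχ0 i x) (by positivity)
    rw [hP2]
    refine (hdwn x).trans (hS.trans ?_)
    have e2 : (Fintype.card ι : ℝ) * ((C + s * C) * Z) = B2 * Z := by rw [hB2]; ring
    rw [e2]
    have k1 : 0 ≤ B1 * (u x ^ 2 / t) := by positivity
    have k2 : 0 ≤ B2 * ((∑ i, χ i x * ‖g i‖ ^ 2) / t) := by positivity
    rw [hZ, add_div]
    linarith
  have J0 : IntegrableOn (fun x => (∑ i, χ i x * ‖gradient u x - u x • F i x‖ ^ 2)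
      + u x ^ 2) Ω := I1.add I4
  have J1 : IntegrableOn (fun x => t * |u x| ^ (2 * (s - 1)) +
      ((∑ i, χ i x * ‖gradient u x - u x • F i x‖ ^ 2) + u x ^ 2) / t) Ω :=
    (I2.const_mul t).add (J0.div_const t)
  have IR : IntegrableOn (fun x => (B1 + B2) * (t * |u x| ^ (2 * (s - 1)) +
      ((∑ i, χ i x * ‖gradient u x - u x • F i x‖ ^ 2) + u x ^ 2) / t)) Ω := J1.const_mul _
  have IR5 : IntegrableOn (fun x => (B1 + B2) * (t * |u x| ^ (2 * (s - 1)) +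
      ((∑ i, χ i x * ‖gradient u x - u x • F i x‖ ^ 2) + u x ^ 2) / t) + ∑ i, br i x) Ω :=
    IR.add I5s
  refine (setIntegral_mono_on I0 IR5 hΩ.measurableSet hpt).trans_eq ?_
  rw [integral_add IR I5s, integral_const_mul, integral_add (I2.const_mul t) (J0.div_const t),
    integral_const_mul, integral_div, integral_add I1 I4, integral_finsetSum _ (fun i _ => I5 i)]
  simp [hibp]

end HSM
namespace HSM

lemma conv {N : ℕ} {g : Euc N → ℝ} (hg : Continuous g) (hc : HasCompactSupport g)
    (h0 : ∀ x, 0 ≤ g x) : ∫⁻ x, ENNReal.ofReal (g x) = ENNReal.ofReal (∫ x, g x) :=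
  (ofReal_integral_eq_lintegral_ofReal (hg.integrable_of_hasCompactSupport hc)
    (Filter.Eventually.of_forall h0)).symm

/-- Gagliardo-Nirenberg-Sobolev inequality in real form. -/
lemma sobolev {N : ℕ} {p : ℝ} (hp : Real.HolderConjugate (N : ℝ) p) :
    ∃ S : ℝ, 0 < S ∧ ∀ w : Euc N → ℝ, ContDiff ℝ 1 w → HasCompactSupport w →
      (∫ x, |w x| ^ p) ≤ S * (∫ x, ‖fderiv ℝ w x‖) ^ p := by
  have hp' : Real.HolderConjugate (Module.finrank ℝ (Euc N) : ℝ) p := by simpa using hp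
  have hp0 : 0 < p := hp.symm.pos
  set S0 : NNReal := lintegralPowLePowLIntegralFDerivConst (volume : Measure (Euc N)) p with hS0
  refine ⟨S0 + 1, by positivity, fun w hw hc => ?_⟩
  have key := lintegral_pow_le_pow_lintegral_fderiv (μ := (volume : Measure (Euc N))) hw hc hp'
  rw [← hS0] at key
  have hI0 : 0 ≤ ∫ x, ‖fderiv ℝ w x‖ := integral_nonneg fun x => norm_nonneg _
  have e1 : ∫⁻ x, ‖w x‖ₑ ^ p = ENNReal.ofReal (∫ x, |w x| ^ p) := by
    rw [← conv]
    · refine lintegral_congr fun x => ?_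
      rw [← ENNReal.ofReal_rpow_of_nonneg (abs_nonneg _) hp0.le, ← Real.norm_eq_abs, ofReal_norm]
    · exact hw.continuous.abs.rpow_const fun x => Or.inr hp0.le
    · exact hc.comp_left (g := fun a : ℝ => |a| ^ p) (by simp [Real.zero_rpow hp0.ne'])
    · intro x; positivity
  have e2 : ∫⁻ x, ‖fderiv ℝ w x‖ₑ = ENNReal.ofReal (∫ x, ‖fderiv ℝ w x‖) := by
    rw [← conv]
    · exact lintegral_congr fun x => (ofReal_norm _).symm
    · exact (hw.continuous_fderiv one_ne_zero).norm
    · exact (hc.fderiv (𝕜 := ℝ)).norm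
    · intro x; positivity
  rw [e1, e2, ENNReal.ofReal_rpow_of_nonneg hI0 hp0.le, ← ENNReal.ofReal_coe_nnreal,
    ← ENNReal.ofReal_mul (by positivity), ENNReal.ofReal_le_ofReal_iff (by positivity)] at key
  refine key.trans ?_
  gcongr
  linarith

lemma final_alg {X Y A B S p : ℝ} (hX : 0 ≤ X) (hY : 0 ≤ Y) (hA : 0 ≤ A) (hB : 0 < B) (hS : 0 < S)
    (hp : 0 < p) (hp2 : p < 2) (h1 : ∀ t : ℝ, 0 < t → Y ≤ B * (t * X + A / t))
    (h2 : X ≤ S * Y ^ p) :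
    (S ^ (2 / p) * (4 * B ^ 2))⁻¹ * X ^ (2 / p - 1) ≤ A := by
  have hpp : 0 < 2 / p - 1 := by
    rw [sub_pos, lt_div_iff₀ hp]; linarith
  rcases hX.eq_or_lt with rfl | hX
  · rw [Real.zero_rpow hpp.ne']; simpa
  have hY : 0 < Y := by
    rcases hY.eq_or_lt with rfl | h
    · rw [Real.zero_rpow hp.ne'] at h2; linarith
    · exact h
  have h3 : Y ^ 2 ≤ 4 * B ^ 2 * A * X := by
    have := h1 (Y / (2 * B * X)) (by positivity)
    have e : B * (Y / (2 * B * X) * X + A / (Y / (2 * B * X))) = Y / 2 + 2 * B ^ 2 * A * X / Y := by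
      field_simp
    rw [e] at this
    have h4 : Y / 2 ≤ 2 * B ^ 2 * A * X / Y := by linarith
    rw [le_div_iff₀ hY] at h4
    nlinarith
  have h5 : X ^ (2 / p) ≤ S ^ (2 / p) * Y ^ 2 := by
    calc X ^ (2 / p) ≤ (S * Y ^ p) ^ (2 / p) := by gcongr
      _ = _ := by
        rw [Real.mul_rpow hS.le (by positivity), ← Real.rpow_mul hY.le, mul_div_cancel₀ _ hp.ne']
        norm_num
  have h6 : X ^ (2 / p - 1) * X = X ^ (2 / p) := by
    rw [← Real.rpow_add_one hX.ne']; congr 1; ring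
  have hSp : 0 < S ^ (2 / p) := by positivity
  rw [inv_mul_le_iff₀ (by positivity)]
  refine le_of_mul_le_mul_right ?_ hX
  rw [h6]
  calc _ ≤ _ := h5
    _ ≤ S ^ (2 / p) * (4 * B ^ 2 * A * X) := by gcongr
    _ = _ := by ring

lemma lower {N : ℕ} (hN : 2 < N) {Ω : Set (Euc N)} (hΩo : IsOpen Ω)
    (hΩb : Bornology.IsBounded Ω) (hΩsm : HasSmoothBoundary Ω) :
    ∃ M c : ℝ, 0 < c ∧ ∀ u : Euc N → ℝ, TestFun Ω u →
      c * (∫ x in Ω, |u x| ^ pStar 2 N) ^ (2 / pStar 2 N) ≤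
        (∫ x in Ω, ‖gradient u x‖ ^ 2) -
          (1 / 4) * (∫ x in Ω, |u x| ^ 2 / (Metric.infDist x (frontier Ω)) ^ 2) +
          M * ∫ x in Ω, |u x| ^ 2 := by
  obtain ⟨ι, _, χ, F, n, C, hC0, hχ, hχ0, hsum, hF, hC1, hC2, hC3⟩ :=
    partition hΩo hΩb hΩsm
  have hNr : (2 : ℝ) < N := by exact_mod_cast hN
  have hN2 : (0 : ℝ) < N - 2 := by linarith
  have hN1 : (0 : ℝ) < N - 1 := by linarith
  set p : ℝ := N / (N - 1) with hp
  set s : ℝ := 2 * (N - 1) / (N - 2) with hs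
  have hp0 : 0 < p := by positivity
  have hp2 : p < 2 := by rw [hp, div_lt_iff₀ hN1]; linarith
  have hs2 : 2 < s := by rw [hs, lt_div_iff₀ hN2]; linarith
  have hpc : Real.HolderConjugate (N : ℝ) p := by
    rw [Real.holderConjugate_iff]
    refine ⟨by linarith, ?_⟩
    rw [hp]; field_simp; ring
  have hsp : s * p = pStar 2 N := by
    rw [hs, hp, pStar]; field_simp
  have hss : 2 * (s - 1) = pStar 2 N := by
    rw [hs, pStar]; field_simp; ring
  have hpe : 2 / p - 1 = 2 / pStar 2 N := by
    rw [hp, pStar]; field_simp; ring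
  obtain ⟨B, hB, hBu⟩ := claimB (n := n) hΩo hs2 hC0 hχ hχ0 hsum hF hC1 hC2
  obtain ⟨S, hS, hSu⟩ := sobolev hpc
  refine ⟨C + 1, (S ^ (2 / p) * (4 * B ^ 2))⁻¹, by positivity, ?_⟩
  rintro u ⟨hu', hcs, hsu⟩
  have hu : ContDiff ℝ 1 u := hu'.of_le (by exact_mod_cast le_top)
  have hA := claimA hΩo hχ hsum hF hC3 hu hcs hsu
  have hA0 : 0 ≤ ∫ x in Ω, ∑ i, χ i x * ‖gradient u x - u x • F i x‖ ^ 2 :=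
    integral_nonneg fun x => Finset.sum_nonneg fun i _ => mul_nonneg (hχ0 i x) (by positivity)
  have hU0 : 0 ≤ ∫ x in Ω, u x ^ 2 := integral_nonneg fun x => sq_nonneg _
  have hu0 : ∀ x, x ∉ Ω → u x = 0 := fun x hx =>
    image_eq_zero_of_notMem_tsupport fun h => hx (hsu h)
  have hw : ContDiff ℝ 1 (fun x => |u x| ^ s) := by
    simpa using hu.norm_rpow (p := s) (by linarith)
  have hcsw : HasCompactSupport (fun x => |u x| ^ s) :=
    hcs.comp_left (g := fun a : ℝ => |a| ^ s)
      (by simp [Real.zero_rpow (show s ≠ 0 by linarith)])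
  have hts : tsupport (fun x => |u x| ^ s) ⊆ tsupport u :=
    closure_mono (fun x hx => by
      simp only [Function.mem_support] at hx ⊢
      exact fun h => hx (by rw [h, abs_zero, Real.zero_rpow (by linarith)]))
  have hsob := hSu _ hw hcsw
  have hps0 : pStar 2 N ≠ 0 := by rw [← hss]; linarith
  have e1 : ∫ x, |(|u x| ^ s)| ^ p = ∫ x in Ω, |u x| ^ pStar 2 N := by
    rw [setInt]
    · refine integral_congr_ae (Filter.Eventually.of_forall fun x => ?_)
      show |(|u x| ^ s)| ^ p = |u x| ^ pStar 2 N
      rw [abs_of_nonneg (by positivity), ← Real.rpow_mul (abs_nonneg _), hsp]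
    · intro x hx
      rw [hu0 x hx, abs_zero, Real.zero_rpow hps0]
  have e2 : ∫ x, ‖fderiv ℝ (fun y => |u y| ^ s) x‖ =
      ∫ x in Ω, ‖fderiv ℝ (fun y => |u y| ^ s) x‖ := by
    rw [setInt]
    intro x hx
    have hx' : x ∉ tsupport (fun x => |u x| ^ s) := fun h => hx (hsu (hts h))
    rw [(notMem_tsupport_iff_eventuallyEq.1 hx').fderiv_eq]; simp
  rw [e1, e2] at hsob
  have hBt := hBu u hu hcs hsu
  rw [hss] at hBt
  have hfin := final_alg (integral_nonneg fun x => by positivity)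
    (integral_nonneg fun x => norm_nonneg _) (add_nonneg hA0 hU0) hB hS hp0 hp2 hBt hsob
  rw [hpe] at hfin
  have e3 : ∀ x, |u x| ^ 2 / (Metric.infDist x (frontier Ω)) ^ 2 = u x ^ 2 * dinv Ω x ^ 2 := by
    intro x; rw [sq_abs, dinv, inv_pow]; rfl
  simp only [e3]
  simp only [sq_abs]
  linarith

end HSM

/-- Example 2.9, inequality (2.18): let `Ω ⊂ ℝ^N`, `N > 2`, be a bounded
domain with smooth boundary and let `λ*` be the supremum (attained, and `> -∞`) of all `λ` such
that the Hardy functional `∫|∇u|² - (1/4)∫|u|²/dist(x,∂Ω)² - λ∫|u|²` is nonnegative on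
`C_0^∞(Ω)`. Then for every `λ < λ*` there is `C_λ > 0` such that
`∫|∇u|² - (1/4)∫|u|²/dist(x,∂Ω)² - λ∫|u|² ≥ C_λ (∫|u|^{2*})^{2/2*}` on `C_0^∞(Ω)`. -/
theorem statement_12 {N : ℕ} (hN : 2 < N) (Ω : Set (Euc N)) (hΩo : IsOpen Ω)
    (hΩc : IsConnected Ω) (hΩb : Bornology.IsBounded Ω) (hΩsm : HasSmoothBoundary Ω)
    (lamStar : ℝ)
    (hlamStar : IsGreatest {lam : ℝ | ∀ u : Euc N → ℝ, TestFun Ω u →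
        0 ≤ (∫ x in Ω, ‖gradient u x‖ ^ 2) -
          (1 / 4) * (∫ x in Ω, |u x| ^ 2 / (Metric.infDist x (frontier Ω)) ^ 2) -
          lam * ∫ x in Ω, |u x| ^ 2} lamStar) :
    ∀ lam : ℝ, lam < lamStar → ∃ C : ℝ, 0 < C ∧ ∀ u : Euc N → ℝ, TestFun Ω u →
      C * (∫ x in Ω, |u x| ^ pStar 2 N) ^ (2 / pStar 2 N) ≤
        (∫ x in Ω, ‖gradient u x‖ ^ 2) -
          (1 / 4) * (∫ x in Ω, |u x| ^ 2 / (Metric.infDist x (frontier Ω)) ^ 2) -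
          lam * ∫ x in Ω, |u x| ^ 2 := by
  intro lam hlam
  obtain ⟨M, c, hc, hM⟩ := HSM.lower hN hΩo hΩb hΩsm
  set L : ℝ := min (-M) (lam - 1) with hL
  have hL1 : L ≤ -M := min_le_left _ _
  have hL2 : L ≤ lam - 1 := min_le_right _ _
  have hd : 0 < lamStar - L := by linarith
  set t : ℝ := (lamStar - lam) / (lamStar - L) with ht
  have ht0 : 0 < t := div_pos (by linarith) hd
  have ht1 : t ≤ 1 := by rw [ht, div_le_one hd]; linarith
  have hte : t * (lamStar - L) = lamStar - lam := div_mul_cancel₀ _ hd.ne'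
  refine ⟨t * c, by positivity, fun u hu => ?_⟩
  have h1 := hM u hu
  have h2 := hlamStar.1 u hu
  have hU : 0 ≤ ∫ x in Ω, |u x| ^ 2 := integral_nonneg fun x => by positivity
  generalize (∫ x in Ω, |u x| ^ 2) = U at *
  generalize (∫ x in Ω, ‖gradient u x‖ ^ 2) = G at *
  generalize (∫ x in Ω, |u x| ^ 2 / (Metric.infDist x (frontier Ω)) ^ 2) = H at *
  generalize (∫ x in Ω, |u x| ^ pStar 2 N) ^ (2 / pStar 2 N) = X at *
  have h3 : c * X ≤ G - 1 / 4 * H - L * U := by nlinarith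
  have h4 := mul_le_mul_of_nonneg_left h3 ht0.le
  have h5 := mul_nonneg (sub_nonneg.2 ht1) h2
  have h6 : G - 1 / 4 * H - lam * U =
      t * (G - 1 / 4 * H - L * U) + (1 - t) * (G - 1 / 4 * H - lamStar * U) := by
    linear_combination (-U) * hte
  rw [h6]
  linarith
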